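/- Let T be a tournament in which some triangle {a,b,c} has two of its pairs, say {a,b} and {b,c}, being diagonals (i.e., T is heavy). Then every x ∈ SA₁(T) has a vertex v ∈ V(T) with x_v ≥ 3/7; in fact, for any lift (x_{pq}) witnessing x ∈ SA₁(T), x_a + x_b + x_c ≥ 1 + x_{ab} + x_{bc}, and if additionally x_v < 3/7 for all vertices v then x_{ab} ≥ 1/7 and x_{bc} ≥ 1/7, yielding max(x_a, x_b, x_c) ≥ 3/7, a contradiction. -/

import Mathlib

variable {V : Type*}

/-- A directed triangle: arcs `a → b`, `b → c`, `c → a`. -/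
def Triangle (arc : V → V → Prop) (a b c : V) : Prop :=
  arc a b ∧ arc b c ∧ arc c a

/-- A tournament: an irreflexive relation with exactly one arc between any two
distinct vertices. -/
def IsTournament (arc : V → V → Prop) : Prop :=
  (∀ v, ¬ arc v v) ∧ ∀ a b : V, a ≠ b → (arc a b ↔ ¬ arc b a)

/-- A feedback vertex set: removing `X` leaves no directed triangle. -/
def IsFVS (arc : V → V → Prop) (X : Set V) : Prop :=
  ∀ a b c : V, a ∉ X → b ∉ X → c ∉ X → ¬ Triangle arc a b c

/-- The constraints of the first level of the Sherali–Adams hierarchy applied to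
the basic relaxation of the feedback vertex set problem of a tournament:
`x` is the vector of vertex variables, `y` the (symmetric) lift over pairs. -/
def SA1Feasible (arc : V → V → Prop) (x : V → ℝ) (y : V → V → ℝ) : Prop :=
  (∀ a b, y a b = y b a) ∧
  (∀ a, 0 ≤ x a ∧ x a ≤ 1) ∧
  (∀ a b c, Triangle arc a b c → 1 + y a b + y b c ≤ x a + x b + x c) ∧
  (∀ a b c d, Triangle arc a b c → d ≠ a → d ≠ b → d ≠ c →
    x d ≤ y a d + y b d + y c d ∧
    1 + y a d + y b d + y c d ≤ x a + x b + x c + x d) ∧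
  (∀ a b, a ≠ b → y a b ≤ x a ∧ 0 ≤ y a b)

/-- `SA₁(T,w)`: the optimum value of the level-1 Sherali-Adams relaxation. -/
noncomputable def SA1Val [Fintype V] (arc : V → V → Prop) (w : V → ℚ) : ℝ :=
  sInf {t : ℝ | ∃ x y, SA1Feasible arc x y ∧ t = ∑ v, (w v : ℝ) * x v}

/-- The pair `{a,b}` is a diagonal: there are `u, v` such that both `{u,v,a}` and
`{u,v,b}` are triangles. -/
def IsDiagonal (arc : V → V → Prop) (a b : V) : Prop :=
  ∃ u v : V, Triangle arc u v a ∧ Triangle arc u v b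

/-- A heavy triangle: a triangle at least two of whose vertex pairs are diagonals. -/
def HeavyTriangle (arc : V → V → Prop) (a b c : V) : Prop :=
  Triangle arc a b c ∧
  ((IsDiagonal arc a b ∧ IsDiagonal arc b c) ∨
   (IsDiagonal arc a b ∧ IsDiagonal arc a c) ∨
   (IsDiagonal arc b c ∧ IsDiagonal arc a c))

/-- A tournament is heavy if it contains a heavy triangle. -/
def IsHeavy (arc : V → V → Prop) : Prop := ∃ a b c : V, HeavyTriangle arc a b c

/-- A tournament is light if it is not heavy. -/
def IsLight (arc : V → V → Prop) : Prop := ¬ IsHeavy arc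

theorem IsTournament.ne_of_arc {arc : V → V → Prop} (hT : IsTournament arc) {a b : V}
    (h : arc a b) : a ≠ b := by
  rintro rfl
  exact hT.1 a h

theorem Triangle.rotate {arc : V → V → Prop} {a b c : V} (h : Triangle arc a b c) :
    Triangle arc b c a :=
  ⟨h.2.1, h.2.2, h.1⟩

/-- The lift value on a diagonal `{a, b}` spanned by the arc `u → v` is at least
`1 - x u - x v`. -/
theorem SA1Feasible.le_of_triangles {arc : V → V → Prop} (hT : IsTournament arc)
    {x : V → ℝ} {y : V → V → ℝ} (hxy : SA1Feasible arc x y) {a b u v : V} (hne : a ≠ b)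
    (ha : Triangle arc u v a) (hb : Triangle arc u v b) : 1 - x u - x v ≤ y a b := by
  obtain ⟨hsymm, -, htri, hext, -⟩ := hxy
  have hcover := (hext u v a b ha (hT.ne_of_arc hb.2.2) (hT.ne_of_arc hb.2.1).symm hne.symm).1
  have hmiddle := htri v b u hb.rotate
  have hub := hsymm u b
  linarith

/-- If all vertex values are below `3/7`, the lift value on a diagonal is at least `1/7`. -/
theorem SA1Feasible.one_div_seven_le_of_isDiagonal {arc : V → V → Prop} (hT : IsTournament arc)
    {x : V → ℝ} {y : V → V → ℝ} (hxy : SA1Feasible arc x y) (hx : ∀ v, x v < 3 / 7)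
    {a b : V} (hne : a ≠ b) (h : IsDiagonal arc a b) : 1 / 7 ≤ y a b := by
  obtain ⟨u, v, ha, hb⟩ := h
  have hlift := hxy.le_of_triangles hT hne ha hb
  linarith [hx u, hx v]

/-- Suppose `T` has a triangle `{a,b,c}` whose pairs `{a,b}` and `{b,c}` are
diagonals (so `T` is heavy). Then for any `(x, y)` satisfying the constraints of
`SA₁(T)`: `x_a + x_b + x_c ≥ 1 + x_{ab} + x_{bc}`; if moreover `x_v < 3/7` for all
vertices then `x_{ab} ≥ 1/7` and `x_{bc} ≥ 1/7`; and some vertex has `x_v ≥ 3/7`. -/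
theorem stmt18 [Fintype V] (arc : V → V → Prop) (hT : IsTournament arc)
    (a b c : V) (htri : Triangle arc a b c)
    (hab : IsDiagonal arc a b) (hbc : IsDiagonal arc b c)
    (x : V → ℝ) (y : V → V → ℝ) (hxy : SA1Feasible arc x y) :
    (1 + y a b + y b c ≤ x a + x b + x c) ∧
    ((∀ v, x v < 3 / 7) → 1 / 7 ≤ y a b ∧ 1 / 7 ≤ y b c) ∧
    (∃ v : V, 3 / 7 ≤ x v) := by
  have hsum := hxy.2.2.1 a b c htri
  have hlift (hx : ∀ v, x v < 3 / 7) : 1 / 7 ≤ y a b ∧ 1 / 7 ≤ y b c :=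
    ⟨hxy.one_div_seven_le_of_isDiagonal hT hx (hT.ne_of_arc htri.1) hab,
      hxy.one_div_seven_le_of_isDiagonal hT hx (hT.ne_of_arc htri.2.1) hbc⟩
  refine ⟨hsum, hlift, ?_⟩
  by_contra! hx
  obtain ⟨h₁, h₂⟩ := hlift hx
  linarith [hx a, hx b, hx c]
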